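/- Let m ≥ 1 be an integer, let y ∈ ℝ^m, let r > 0 and ε > 0. Let v be a real-valued function that is continuous on the closed ball cl(B_r(y)), twice continuously differentiable on the open ball B_r(y), satisfies Δv(x) ≥ −1 for every x ∈ B_r(y), and satisfies v(y) ≥ ε. Then ∫_{B_r(y)} v(x) dx ≥ ω_m r^m (ε − r²/(2(m+2))). -/

import Mathlib

open MeasureTheory Metric

/-- The Laplacian of a function on Euclidean space: the sum of the pure second
partial derivatives. -/
noncomputable def laplacian {m : ℕ} (u : EuclideanSpace ℝ (Fin m) → ℝ)
    (x : EuclideanSpace ℝ (Fin m)) : ℝ :=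
  ∑ i : Fin m, fderiv ℝ (fun y => fderiv ℝ u y (EuclideanSpace.single i 1)) x
    (EuclideanSpace.single i 1)

section BallWeight

variable {E : Type*} [NormedAddCommGroup E]

/-- The function `(1 - ‖x‖²) / 2` on the unit ball, extended by zero. -/
noncomputable def ballWeight (x : E) : ℝ := (1 - (min 1 ‖x‖) ^ 2) / 2

lemma ballWeight_nonneg (x : E) : 0 ≤ ballWeight x := by
  have h0 : 0 ≤ min 1 ‖x‖ := le_min zero_le_one (norm_nonneg x)
  have h1 : min 1 ‖x‖ ≤ 1 := min_le_left _ _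
  unfold ballWeight
  nlinarith

lemma ballWeight_of_mem {x : E} (hx : x ∈ ball (0 : E) 1) :
    ballWeight x = (1 - ‖x‖ ^ 2) / 2 := by
  rw [ballWeight, min_eq_right (mem_ball_zero_iff.1 hx).le]

lemma ballWeight_of_notMem {x : E} (hx : x ∉ ball (0 : E) 1) : ballWeight x = 0 := by
  rw [ballWeight, min_eq_left (by simpa using hx)]
  norm_num

lemma lipschitzWith_ballWeight : LipschitzWith 1 (ballWeight : E → ℝ) := by
  refine LipschitzWith.of_dist_le_mul fun x z => ?_
  have hx0 : 0 ≤ min 1 ‖x‖ := le_min zero_le_one (norm_nonneg x)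
  have hz0 : 0 ≤ min 1 ‖z‖ := le_min zero_le_one (norm_nonneg z)
  have hx1 : min 1 ‖x‖ ≤ 1 := min_le_left _ _
  have hz1 : min 1 ‖z‖ ≤ 1 := min_le_left _ _
  have h1 : |min 1 ‖x‖ - min 1 ‖z‖| ≤ dist x z := by
    calc |min 1 ‖x‖ - min 1 ‖z‖| ≤ max |(1 : ℝ) - 1| |‖x‖ - ‖z‖| :=
          abs_min_sub_min_le_max _ _ _ _
      _ ≤ dist x z := by
          simpa [dist_eq_norm] using abs_norm_sub_norm_le x z
  rw [Real.dist_eq, NNReal.coe_one, one_mul]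
  refine le_trans ?_ h1
  have : ballWeight x - ballWeight z
      = -((min 1 ‖x‖ - min 1 ‖z‖) * ((min 1 ‖x‖ + min 1 ‖z‖) / 2)) := by
    unfold ballWeight; ring
  rw [this, abs_neg, abs_mul]
  refine mul_le_of_le_one_right (abs_nonneg _) ?_
  rw [abs_of_nonneg (by positivity)]
  linarith

lemma continuous_ballWeight : Continuous (ballWeight : E → ℝ) :=
  lipschitzWith_ballWeight.continuous

lemma hasCompactSupport_ballWeight [ProperSpace E] :
    HasCompactSupport (ballWeight : E → ℝ) :=
  HasCompactSupport.intro (isCompact_closedBall (0 : E) 1) fun _ hx =>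
    ballWeight_of_notMem fun h => hx (ball_subset_closedBall h)

variable [InnerProductSpace ℝ E]

lemma lineDeriv_ballWeight_of_mem {x : E} (hx : x ∈ ball (0 : E) 1) (e : E) :
    lineDeriv ℝ ballWeight x e = -inner ℝ x e := by
  have h : ballWeight =ᶠ[nhds x] fun z : E => (1 - ‖z‖ ^ 2) / 2 := by
    filter_upwards [isOpen_ball.mem_nhds hx] with z hz using ballWeight_of_mem hz
  rw [h.lineDeriv_eq]
  have h1 : HasFDerivAt (fun z : E => (1 - ‖z‖ ^ 2) / 2) (-innerSL ℝ x) x := by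
    have := (((hasStrictFDerivAt_norm_sq x).hasFDerivAt.const_sub 1).mul_const (1 / 2 : ℝ))
    refine (this.congr_fderiv ?_).congr_of_eventuallyEq ?_
    · ext z; simp
    · exact Filter.Eventually.of_forall fun z => by simp [div_eq_mul_inv]
  rw [(h1.hasLineDerivAt e).lineDeriv]
  simp

lemma lineDeriv_ballWeight_of_notMem {x : E} (hx : x ∉ closedBall (0 : E) 1) (e : E) :
    lineDeriv ℝ ballWeight x e = 0 := by
  have h : ballWeight =ᶠ[nhds x] fun _ : E => (0 : ℝ) := by
    filter_upwards [isClosed_closedBall.isOpen_compl.mem_nhds hx] with z hz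
    exact ballWeight_of_notMem fun h => hz (ball_subset_closedBall h)
  rw [h.lineDeriv_eq]
  simp [lineDeriv]

variable [FiniteDimensional ℝ E] [Nontrivial E] [MeasurableSpace E] [BorelSpace E]

lemma integral_ballWeight (μ : Measure E) [μ.IsAddHaarMeasure] :
    ∫ x, ballWeight x ∂μ = μ.real (ball 0 1) / (Module.finrank ℝ E + 2) := by
  have hn : 0 < Module.finrank ℝ E := Module.finrank_pos
  obtain ⟨n, hn⟩ : ∃ n, Module.finrank ℝ E = n + 1 := ⟨_, (Nat.succ_pred_eq_of_pos hn).symm⟩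
  have h := integral_fun_norm_addHaar μ (fun s : ℝ => (1 - (min 1 s) ^ 2) / 2)
  change ∫ x, ballWeight x ∂μ = _ at h
  rw [h, hn, Nat.add_sub_cancel]
  have hI : ∫ s in Set.Ioi (0 : ℝ), s ^ n • ((1 - (min 1 s) ^ 2) / 2)
      = 1 / ((n + 1) * (n + 3) : ℝ) := by
    rw [setIntegral_eq_of_subset_of_forall_sdiff_eq_zero measurableSet_Ioi
      (s := Set.Ioc (0 : ℝ) 1) Set.Ioc_subset_Ioi_self,
      ← intervalIntegral.integral_of_le zero_le_one]
    · rw [intervalIntegral.integral_congr (g := fun s : ℝ => s ^ n / 2 - s ^ (n + 2) / 2)]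
      · rw [intervalIntegral.integral_sub (Continuous.intervalIntegrable (by fun_prop) _ _)
          (Continuous.intervalIntegrable (by fun_prop) _ _)]
        simp only [intervalIntegral.integral_div, integral_pow]
        push_cast
        simp
        field_simp
        ring
      · intro s hs
        rw [Set.uIcc_of_le zero_le_one] at hs
        simp only [min_eq_right hs.2, smul_eq_mul]
        ring
    · intro s hs
      have : 1 ≤ s := by
        by_contra! h
        exact hs.2 ⟨hs.1, h.le⟩
      simp [min_eq_left this]
  rw [hI]
  simp only [nsmul_eq_mul, smul_eq_mul]
  push_cast
  field_simp
  ring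

/-- Integration by parts against `ballWeight`. -/
lemma setIntegral_mul_inner_eq_integral_lineDeriv_mul_ballWeight
    (μ : Measure E) [μ.IsAddHaarMeasure] {C : NNReal} {f : E → ℝ} (hf : LipschitzWith C f) (e : E) :
    ∫ x in ball (0 : E) 1, f x * inner ℝ x e ∂μ = ∫ x, lineDeriv ℝ f x e * ballWeight x ∂μ := by
  rw [hf.integral_lineDeriv_mul_eq lipschitzWith_ballWeight hasCompactSupport_ballWeight,
    ← integral_indicator measurableSet_ball]
  refine integral_congr_ae ?_
  filter_upwards [measure_eq_zero_iff_ae_notMem.1 (Measure.addHaar_sphere μ (0 : E) 1)] with x hx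
  by_cases h : x ∈ ball (0 : E) 1
  · rw [Set.indicator_of_mem h, lineDeriv_ballWeight_of_mem h]
    simp [mul_comm]
  · have h' : x ∉ closedBall (0 : E) 1 := fun hc => by
      rw [← ball_union_sphere] at hc
      exact hc.elim h hx
    rw [Set.indicator_of_notMem h, lineDeriv_ballWeight_of_notMem h', zero_mul]

end BallWeight

section MeanValue

variable {m : ℕ}

lemma Filter.EventuallyEq.laplacian_eq {u w : EuclideanSpace ℝ (Fin m) → ℝ}
    {x : EuclideanSpace ℝ (Fin m)} (h : u =ᶠ[nhds x] w) : laplacian u x = laplacian w x := by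
  unfold laplacian
  refine Finset.sum_congr rfl fun i _ => ?_
  have : (fun z => fderiv ℝ u z (EuclideanSpace.single i 1))
      =ᶠ[nhds x] fun z => fderiv ℝ w z (EuclideanSpace.single i 1) := by
    filter_upwards [h.fderiv (𝕜 := ℝ)] with z hz
    rw [hz]
  rw [this.fderiv_eq]

variable {V : EuclideanSpace ℝ (Fin m) → ℝ}

lemma ContDiff.fderiv_apply_const (hV : ContDiff ℝ 2 V) (e : EuclideanSpace ℝ (Fin m)) :
    ContDiff ℝ 1 fun z => fderiv ℝ V z e :=
  (hV.fderiv_right (m := 1) (by norm_num)).clm_apply contDiff_const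

lemma ContDiff.continuous_laplacian (hV : ContDiff ℝ 2 V) : Continuous (laplacian V) :=
  continuous_finsetSum _ fun _ _ =>
    ((hV.fderiv_apply_const _).continuous_fderiv one_ne_zero).clm_apply continuous_const

/-- The derivative of `t ↦ ∫ V (y + t x)` over the unit ball, expressed through the Laplacian. -/
lemma hasDerivAt_setIntegral_comp_add_smul [NeZero m] (hV : ContDiff ℝ 2 V)
    (hc : HasCompactSupport V) (y : EuclideanSpace ℝ (Fin m)) (t : ℝ) :
    HasDerivAt (fun s : ℝ => ∫ x in ball (0 : EuclideanSpace ℝ (Fin m)) 1, V (y + s • x))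
      (∫ x, t * laplacian V (y + t • x) * ballWeight x) t := by
  have hV1 : Differentiable ℝ V := hV.differentiable (by norm_num)
  have hcont : Continuous (fderiv ℝ V) := hV.continuous_fderiv (by norm_num)
  have hfin : volume (ball (0 : EuclideanSpace ℝ (Fin m)) 1) ≠ ⊤ := measure_ball_lt_top.ne
  obtain ⟨C, hC⟩ := (hc.fderiv ℝ).exists_bound_of_continuous hcont
  have hderiv := (hasDerivAt_integral_of_dominated_loc_of_deriv_le
    (μ := volume.restrict (ball (0 : EuclideanSpace ℝ (Fin m)) 1))
    (F := fun s x => V (y + s • x)) (F' := fun s x => fderiv ℝ V (y + s • x) x)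
    (x₀ := t) (s := Set.univ) (bound := fun _ => C) Filter.univ_mem
    (Filter.Eventually.of_forall fun s =>
      (hV.continuous.comp (by fun_prop)).aestronglyMeasurable)
    (((hV.continuous.comp (by fun_prop : Continuous fun x => y + t • x)).continuousOn
      |>.integrableOn_compact (isCompact_closedBall 0 1)).mono_set ball_subset_closedBall)
    (by
      refine Continuous.aestronglyMeasurable ?_
      exact (hcont.comp (by fun_prop : Continuous fun x => y + t • x)).clm_apply continuous_id)
    (by
      filter_upwards [ae_restrict_mem measurableSet_ball] with x hx s _
      refine ((fderiv ℝ V (y + s • x)).le_opNorm x).trans ?_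
      have h0 := norm_nonneg (fderiv ℝ V (y + s • x))
      have h1 := hC (y + s • x)
      have h2 : ‖x‖ < 1 := mem_ball_zero_iff.1 hx
      nlinarith [norm_nonneg x])
    (integrableOn_const hfin)
    (by
      refine Filter.Eventually.of_forall fun x s _ => ?_
      have h1 : HasDerivAt (fun s : ℝ => y + s • x) x s := by
        simpa using ((hasDerivAt_id s).smul_const x).const_add y
      exact (hV1 (y + s • x)).hasFDerivAt.comp_hasDerivAt s h1)).2
  refine hderiv.congr_deriv (Eq.symm ?_)
  have hsum : ∀ x : EuclideanSpace ℝ (Fin m), fderiv ℝ V (y + t • x) x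
      = ∑ i, fderiv ℝ V (y + t • x) (EuclideanSpace.single i 1)
        * inner ℝ x (EuclideanSpace.single i 1) := fun x => by
    generalize fderiv ℝ V (y + t • x) = L
    conv_lhs => rw [← (EuclideanSpace.basisFun (Fin m) ℝ).sum_repr x]
    simp [map_sum, mul_comm, EuclideanSpace.inner_single_right]
  have hlip : ∀ i : Fin m, ∃ D, LipschitzWith D
      fun x => fderiv ℝ V (y + t • x) (EuclideanSpace.single i 1) := fun i => by
    obtain ⟨D, hD⟩ := ContDiff.lipschitzWith_of_hasCompactSupport
      ((hc.fderiv_apply ℝ (EuclideanSpace.single i 1)))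
      (hV.fderiv_apply_const (EuclideanSpace.single i 1)) one_ne_zero
    exact ⟨_, hD.comp ((LipschitzWith.const y).add (lipschitzWith_smul t))⟩
  have hline : ∀ (i : Fin m) (x : EuclideanSpace ℝ (Fin m)),
      lineDeriv ℝ (fun x => fderiv ℝ V (y + t • x) (EuclideanSpace.single i 1)) x
        (EuclideanSpace.single i 1)
      = t * fderiv ℝ (fun z => fderiv ℝ V z (EuclideanSpace.single i 1)) (y + t • x)
          (EuclideanSpace.single i 1) := fun i x => by
    have h1 : HasFDerivAt (fun x : EuclideanSpace ℝ (Fin m) => y + t • x)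
        (t • ContinuousLinearMap.id ℝ _) x := ((hasFDerivAt_id x).const_smul t).const_add y
    have h2 := ((hV.fderiv_apply_const (EuclideanSpace.single i 1)).differentiable
      one_ne_zero (y + t • x)).hasFDerivAt.comp x h1
    have h3 := (h2.hasLineDerivAt (EuclideanSpace.single i 1)).lineDeriv
    simpa [Function.comp_def] using h3
  have hint1 : ∀ i : Fin m, IntegrableOn (fun x => fderiv ℝ V (y + t • x)
      (EuclideanSpace.single i 1) * inner ℝ x (EuclideanSpace.single i 1))
      (ball (0 : EuclideanSpace ℝ (Fin m)) 1) := fun i => by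
    have hci := (hV.fderiv_apply_const (EuclideanSpace.single i 1)).continuous
    exact (((hci.comp (by fun_prop : Continuous fun x => y + t • x)).mul
      (by fun_prop)).continuousOn.integrableOn_compact (isCompact_closedBall 0 1)).mono_set
        ball_subset_closedBall
  have hint2 : ∀ i : Fin m, Integrable fun x : EuclideanSpace ℝ (Fin m) =>
      t * fderiv ℝ (fun z => fderiv ℝ V z (EuclideanSpace.single i 1)) (y + t • x)
          (EuclideanSpace.single i 1) * ballWeight x := fun i => by
    have hci := (hV.fderiv_apply_const (EuclideanSpace.single i 1)).continuous_fderiv one_ne_zero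
    refine Continuous.integrable_of_hasCompactSupport ?_ hasCompactSupport_ballWeight.mul_left
    exact (continuous_const.mul ((hci.comp (by fun_prop : Continuous fun x => y + t • x)).clm_apply
      continuous_const)).mul continuous_ballWeight
  simp only [laplacian, hsum, Finset.mul_sum, Finset.sum_mul]
  rw [integral_finsetSum _ fun i _ => hint1 i, integral_finsetSum _ fun i _ => hint2 i]
  refine Finset.sum_congr rfl fun i _ => ?_
  obtain ⟨D, hD⟩ := hlip i
  rw [setIntegral_mul_inner_eq_integral_lineDeriv_mul_ballWeight volume hD]
  simp only [hline]

/-- Lower mean value inequality for a globally `C²` function with `Δ V ≥ -1` on a ball. -/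
lemma mul_le_setIntegral_of_neg_one_le_laplacian [NeZero m] (hV : ContDiff ℝ 2 V)
    (hc : HasCompactSupport V) {y : EuclideanSpace ℝ (Fin m)} {ρ : ℝ} (hρ : 0 ≤ ρ)
    (hlap : ∀ x ∈ ball y ρ, -1 ≤ laplacian V x) :
    volume.real (ball (0 : EuclideanSpace ℝ (Fin m)) 1) * (V y - ρ ^ 2 / (2 * (m + 2)))
      ≤ ∫ x in ball (0 : EuclideanSpace ℝ (Fin m)) 1, V (y + ρ • x) := by
  set c : ℝ := volume.real (ball (0 : EuclideanSpace ℝ (Fin m)) 1) / (m + 2) with hcdef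
  have hw : ∫ x : EuclideanSpace ℝ (Fin m), ballWeight x = c := by
    simpa using integral_ballWeight (volume : Measure (EuclideanSpace ℝ (Fin m)))
  have hwint : Integrable (ballWeight : EuclideanSpace ℝ (Fin m) → ℝ) :=
    continuous_ballWeight.integrable_of_hasCompactSupport hasCompactSupport_ballWeight
  have hd : ∀ t : ℝ, HasDerivAt (fun s : ℝ =>
      (∫ x in ball (0 : EuclideanSpace ℝ (Fin m)) 1, V (y + s • x)) + s ^ 2 / 2 * c)
      ((∫ x, t * laplacian V (y + t • x) * ballWeight x) + t * c) t := fun t => by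
    refine (hasDerivAt_setIntegral_comp_add_smul hV hc y t).add (HasDerivAt.mul_const ?_ c)
    simpa using (hasDerivAt_pow 2 t).div_const 2
  have hmono := monotoneOn_of_deriv_nonneg (convex_Icc 0 ρ)
    (fun t _ => (hd t).continuousAt.continuousWithinAt)
    (fun t _ => (hd t).differentiableAt.differentiableWithinAt)
    (fun t ht => by
      rw [interior_Icc] at ht
      have hlapint : Integrable fun x : EuclideanSpace ℝ (Fin m) =>
          t * laplacian V (y + t • x) * ballWeight x := by
        refine Continuous.integrable_of_hasCompactSupport ?_ hasCompactSupport_ballWeight.mul_left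
        exact (continuous_const.mul (hV.continuous_laplacian.comp (by fun_prop))).mul
          continuous_ballWeight
      rw [(hd t).deriv, ← hw, ← integral_const_mul, ← integral_add hlapint (hwint.const_mul t)]
      refine integral_nonneg fun x => ?_
      by_cases hx : x ∈ ball (0 : EuclideanSpace ℝ (Fin m)) 1
      · have hmem : y + t • x ∈ ball y ρ := by
          rw [mem_ball_zero_iff] at hx
          rw [mem_ball_iff_norm, add_sub_cancel_left, norm_smul, Real.norm_of_nonneg ht.1.le]
          nlinarith [ht.1, ht.2]
        have h1 : 0 ≤ laplacian V (y + t • x) + 1 := by linarith [hlap _ hmem]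
        have h2 := mul_nonneg (mul_nonneg ht.1.le h1) (ballWeight_nonneg x)
        simp only [Pi.zero_apply]
        linarith
      · simp [ballWeight_of_notMem hx])
  have h := hmono (Set.left_mem_Icc.2 hρ) (Set.right_mem_Icc.2 hρ) hρ
  simp only [zero_smul, add_zero, setIntegral_const, smul_eq_mul] at h
  have : volume.real (ball (0 : EuclideanSpace ℝ (Fin m)) 1) * (V y - ρ ^ 2 / (2 * (m + 2)))
    = volume.real (ball (0 : EuclideanSpace ℝ (Fin m)) 1) * V y - ρ ^ 2 / 2 * c := by
    rw [hcdef]; field_simp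
  rw [this]
  linarith

end MeanValue

/-- Lower integral bound used in the proof of Theorem 4.1: if `Δv ≥ −1` on `B_r(y)`,
`v` is continuous on the closed ball and twice continuously differentiable inside,
and `v(y) ≥ ε`, then `∫_{B_r(y)} v ≥ ω_m r^m (ε − r²/(2(m+2)))`. -/
theorem stmt12 (m : ℕ) (hm : 1 ≤ m) (y : EuclideanSpace ℝ (Fin m)) (r ε : ℝ)
    (hr : 0 < r) (hε : 0 < ε)
    (ω : ℝ) (hω : ω = (volume (ball (0 : EuclideanSpace ℝ (Fin m)) 1)).toReal)
    (v : EuclideanSpace ℝ (Fin m) → ℝ)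
    (hvcont : ContinuousOn v (closure (ball y r)))
    (hvdiff : ContDiffOn ℝ 2 v (ball y r))
    (hvlap : ∀ x ∈ ball y r, -1 ≤ laplacian v x)
    (hvy : ε ≤ v y) :
    ω * r ^ m * (ε - r ^ 2 / (2 * (m + 2))) ≤ ∫ x in ball y r, v x := by
  have : NeZero m := ⟨by omega⟩
  rw [closure_ball y hr.ne'] at hvcont
  have hinner : ∀ t ∈ Set.Ioo 0 r, ω * (v y - t ^ 2 / (2 * (m + 2)))
      ≤ ∫ x in ball (0 : EuclideanSpace ℝ (Fin m)) 1, v (y + t • x) := by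
    intro t ht
    obtain ⟨s, hts, hsr⟩ := exists_between ht.2
    let χ : ContDiffBump y := ⟨t, s, ht.1, hts⟩
    have hV : ContDiff ℝ 2 fun x => χ x * v x := by
      rw [contDiff_iff_contDiffAt]
      intro x
      by_cases hx : x ∈ ball y r
      · exact χ.contDiffAt.mul (hvdiff.contDiffAt (isOpen_ball.mem_nhds hx))
      · have hx' : x ∉ closedBall y s := fun h => hx (closedBall_subset_ball hsr h)
        refine (contDiffAt_const (c := (0 : ℝ))).congr_of_eventuallyEq ?_
        filter_upwards [isClosed_closedBall.isOpen_compl.mem_nhds hx'] with z hz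
        rw [χ.zero_of_le_dist (not_le.1 fun h => hz h).le, zero_mul]
    have hχ : ∀ x ∈ closedBall y t, χ x = 1 := fun x hx => χ.one_of_mem_closedBall hx
    have h := mul_le_setIntegral_of_neg_one_le_laplacian hV χ.hasCompactSupport.mul_right
      ht.1.le (y := y) (fun x hx => by
        have : (fun x => χ x * v x) =ᶠ[nhds x] v := by
          filter_upwards [isOpen_ball.mem_nhds hx] with z hz
          rw [hχ z (ball_subset_closedBall hz), one_mul]
        rw [this.laplacian_eq]
        exact hvlap x (ball_subset_ball ht.2.le hx))
    rw [hω]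
    refine le_trans (le_of_eq ?_) (h.trans (le_of_eq ?_))
    · rw [hχ y (mem_closedBall_self ht.1.le), one_mul, measureReal_def]
    · refine setIntegral_congr_fun measurableSet_ball fun x hx => ?_
      have hmem : y + t • x ∈ closedBall y t := by
        rw [mem_ball_zero_iff] at hx
        rw [mem_closedBall_iff_norm, add_sub_cancel_left, norm_smul, Real.norm_of_nonneg ht.1.le]
        nlinarith [ht.1]
      simp only [hχ _ hmem, one_mul]
  have hmaps : ∀ t ∈ Set.Icc 0 r, ∀ x ∈ ball (0 : EuclideanSpace ℝ (Fin m)) 1,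
      y + t • x ∈ closedBall y r := by
    intro t ht x hx
    rw [mem_ball_zero_iff] at hx
    rw [mem_closedBall_iff_norm, add_sub_cancel_left, norm_smul, Real.norm_of_nonneg ht.1]
    nlinarith [ht.1, ht.2, norm_nonneg x]
  have hscaled : ω * (v y - r ^ 2 / (2 * (m + 2)))
      ≤ ∫ x in ball (0 : EuclideanSpace ℝ (Fin m)) 1, v (y + r • x) := by
    obtain ⟨C, hC⟩ := (isCompact_closedBall y r).exists_bound_of_continuousOn hvcont
    have hcw : ContinuousWithinAt (fun t : ℝ =>
        ∫ x in ball (0 : EuclideanSpace ℝ (Fin m)) 1, v (y + t • x)) (Set.Ioo 0 r) r := by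
      refine continuousWithinAt_of_dominated (bound := fun _ => C) ?_ ?_
        (integrableOn_const measure_ball_lt_top.ne) ?_
      · filter_upwards [self_mem_nhdsWithin] with t ht
        refine ContinuousOn.aestronglyMeasurable ?_ measurableSet_ball
        exact hvcont.comp (by fun_prop) fun x hx => hmaps t (Set.Ioo_subset_Icc_self ht) x hx
      · filter_upwards [self_mem_nhdsWithin] with t ht
        filter_upwards [ae_restrict_mem measurableSet_ball] with x hx
        exact hC _ (hmaps t (Set.Ioo_subset_Icc_self ht) x hx)
      · filter_upwards [ae_restrict_mem measurableSet_ball] with x hx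
        have h1 : ContinuousOn (fun t : ℝ => v (y + t • x)) (Set.Icc 0 r) :=
          hvcont.comp (by fun_prop) fun t ht => hmaps t ht x hx
        exact (h1 r (Set.right_mem_Icc.2 hr.le)).mono Set.Ioo_subset_Icc_self
    have hne : (nhdsWithin r (Set.Ioo 0 r)).NeBot := by
      rw [← mem_closure_iff_nhdsWithin_neBot, closure_Ioo hr.ne]
      exact Set.right_mem_Icc.2 hr.le
    have hcl : ContinuousWithinAt (fun t : ℝ => ω * (v y - t ^ 2 / (2 * (m + 2))))
        (Set.Ioo 0 r) r := by
      exact Continuous.continuousWithinAt (by fun_prop)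
    exact le_of_tendsto_of_tendsto hcl hcw (by
      filter_upwards [self_mem_nhdsWithin] with t ht using hinner t ht)
  have hcov : ∫ x in ball y r, v x
      = r ^ m * ∫ x in ball (0 : EuclideanSpace ℝ (Fin m)) 1, v (y + r • x) := by
    have h1 := Measure.setIntegral_comp_smul_of_pos volume
      (fun x : EuclideanSpace ℝ (Fin m) => v (y + x)) (ball 0 1) hr
    rw [h1, smul_unitBall hr.ne', Real.norm_of_nonneg hr.le, finrank_euclideanSpace_fin,
      smul_eq_mul, mul_inv_cancel_left₀ (by positivity)]
    have h2 := (measurePreserving_add_left volume y).setIntegral_preimage_emb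
      (MeasurableEquiv.addLeft y).measurableEmbedding v (ball y r)
    rw [← h2]
    simp
  have hω0 : 0 ≤ ω := hω ▸ ENNReal.toReal_nonneg
  rw [hcov]
  calc ω * r ^ m * (ε - r ^ 2 / (2 * (m + 2)))
      = r ^ m * (ω * (ε - r ^ 2 / (2 * (m + 2)))) := by ring
    _ ≤ r ^ m * (ω * (v y - r ^ 2 / (2 * (m + 2)))) := by gcongr
    _ ≤ _ := by gcongr
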